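/- Let c0, c1, c2, c3, c4 be generic real numbers satisfying c0+c1+c2+c3+c4 = −2N−3 for an integer N ≥ 0. Then for all integers a, j, y ≥ 0 with a + j ≤ N and a + y ≤ N one has Λ(y; c3,c0; N) / Λ(j; c4,c0; N) = [ Ω(y; c4,c0,c3; N−a) · Ω(a; c3,c2,c1; N−j) ] / [ Ω(j; c3,c0,c4; N−a) · Ω(a; c4,c2,c1; N−y) ]. -/

import Mathlib

open Finset

noncomputable section

/-- Pochhammer symbol `(a)_k = a (a+1) ⋯ (a+k-1)`. -/
def poch (a : ℝ) (k : ℕ) : ℝ := ∏ i ∈ Finset.range k, (a + i)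

/-- A real number is *generic* if it is not an integer. -/
def Generic (r : ℝ) : Prop := ∀ m : ℤ, r ≠ (m : ℝ)

/-- Genericity for three parameters: none of the parameters, nor any sum of two or three
of them, is an integer; this guarantees that no denominator vanishes. -/
def Generic3 (c1 c2 c3 : ℝ) : Prop :=
  Generic c1 ∧ Generic c2 ∧ Generic c3 ∧
  Generic (c1+c2) ∧ Generic (c1+c3) ∧ Generic (c2+c3) ∧
  Generic (c1+c2+c3)

/-- Genericity for four parameters: none of the parameters, nor any sum of two, three or
four of them, is an integer; this guarantees that no denominator vanishes. -/
def Generic4 (c1 c2 c3 c4 : ℝ) : Prop :=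
  Generic c1 ∧ Generic c2 ∧ Generic c3 ∧ Generic c4 ∧
  Generic (c1+c2) ∧ Generic (c1+c3) ∧ Generic (c1+c4) ∧
  Generic (c2+c3) ∧ Generic (c2+c4) ∧ Generic (c3+c4) ∧
  Generic (c1+c2+c3) ∧ Generic (c1+c2+c4) ∧ Generic (c1+c3+c4) ∧ Generic (c2+c3+c4) ∧
  Generic (c1+c2+c3+c4)

/-- Normalization `Ω(n; c1,c2,c3; M)`. -/
def Om (n : ℤ) (c1 c2 c3 : ℝ) (M : ℤ) : ℝ :=
  (M.toNat.choose n.toNat : ℝ) * (2*(n:ℝ) + c2 + c3 + 1) *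
    poch (c2+1) n.toNat * poch ((M:ℝ)+2+c1+c2+c3) n.toNat * poch (c1+1) (M-n).toNat /
    (poch (c3+1) n.toNat * poch (c2+c3+(n:ℝ)+1) (M.toNat+1))

/-- The renormalized Racah polynomial `p_n(x; c1,c2,c3; M)`, with the convention that it
vanishes unless `0 ≤ n ≤ M`. -/
def racah (n : ℤ) (x : ℝ) (c1 c2 c3 : ℝ) (M : ℤ) : ℝ :=
  if 0 ≤ n ∧ n ≤ M then
    Om n c1 c2 c3 M *
      ∑ k ∈ Finset.range (n.toNat + 1),
        (poch (-(n:ℝ)) k * poch ((n:ℝ)+c2+c3+1) k * poch (-x) k * poch (x+c1+c2+1) k) /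
        (poch (c2+1) k * poch ((M:ℝ)+2+c1+c2+c3) k * poch (-(M:ℝ)) k * (Nat.factorial k : ℝ))
  else 0

/-- Weight `Λ(x; c1,c2; M)`. -/
def Lam (x : ℤ) (c1 c2 : ℝ) (M : ℤ) : ℝ :=
  (-1:ℝ)^x.toNat * (M.toNat.choose x.toNat : ℝ) * (2*(x:ℝ)+c1+c2+1) * poch (c2+1) x.toNat /
    (poch (c1+1) x.toNat * poch ((x:ℝ)+c1+c2+1) (M.toNat+1))

/-- `λ(x; c) = x(x+c+1)`. -/
def lam (x c : ℝ) : ℝ := x*(x+c+1)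

/-- `μ_n(c) = n(n+c+1)`. -/
def mu (n c : ℝ) : ℝ := n*(n+c+1)

/-- Recurrence coefficient `A_n(c1,c2,c3; M)`. -/
def coefA (n c1 c2 c3 M : ℝ) : ℝ :=
  (n-M)*(n+c1+c2+c3+M+2)*(n+c2+1)*(n+c2+c3+1)/((2*n+c2+c3+1)*(2*n+c2+c3+2))

/-- Recurrence coefficient `C_n(c1,c2,c3; M)`. -/
def coefC (n c1 c2 c3 M : ℝ) : ℝ :=
  n*(n-c1-M-1)*(n+c2+c3+M+1)*(n+c3)/((2*n+c2+c3)*(2*n+c2+c3+1))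

/-- `Σ_n = A_n + C_n`. -/
def coefSig (n c1 c2 c3 M : ℝ) : ℝ := coefA n c1 c2 c3 M + coefC n c1 c2 c3 M

/-- Difference coefficient `B(x; c1,c2,c3; M)`. -/
def coefB (x c1 c2 c3 M : ℝ) : ℝ :=
  (x-M)*(x+c2+1)*(x+c1+c2+c3+M+2)*(x+c1+c2+1)/((2*x+c1+c2+1)*(2*x+c1+c2+2))

/-- Difference coefficient `D(x; c1,c2,c3; M)`. -/
def coefD (x c1 c2 c3 M : ℝ) : ℝ :=
  x*(x+c1)*(x-c3-M-1)*(x+c1+c2+M+1)/((2*x+c1+c2)*(2*x+c1+c2+1))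

/-- `S = B + D`. -/
def coefS (x c1 c2 c3 M : ℝ) : ℝ := coefB x c1 c2 c3 M + coefD x c1 c2 c3 M

/-- `F(x; c1,c2)`. -/
def Ffun (x c1 c2 : ℝ) : ℝ :=
  (x+c2+1)*(x+c1+c2+1)/((2*x+c1+c2+1)*(2*x+c1+c2+2))

/-- `λ⁺(x; c12; M) = (x+c12+M+2)(x−M−1)`. -/
def lamP (x c12 M : ℝ) : ℝ := (x+c12+M+2)*(x-M-1)

/-- `A⁺_n(c2,c3; M)`. -/
def Ap (n c2 c3 M : ℝ) : ℝ := -(n-M-1)*(n-M)*Ffun n c3 c2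

/-- `C⁺_n(c2,c3; M) = A⁺_{−n−c23−1}(c2,c3; M)`. -/
def Cp (n c2 c3 M : ℝ) : ℝ := Ap (-n-c2-c3-1) c2 c3 M

/-- `Σ⁺_n = A⁺_n + C⁺_n + (M+1)(M+1+c3)`. -/
def Sp (n c2 c3 M : ℝ) : ℝ := Ap n c2 c3 M + Cp n c2 c3 M + (M+1)*(M+1+c3)

/-- `λ⁻(x; c123, c3; M) = (x+c123+M+1)(x−M−c3)`. -/
def lamM (x c123 c3 M : ℝ) : ℝ := (x+c123+M+1)*(x-M-c3)

/-- `A⁻_n(c1,c2,c3; M)`. -/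
def Am (n c1 c2 c3 M : ℝ) : ℝ := -(n+c1+c2+c3+M+1)*(n+c1+c2+c3+M+2)*Ffun n c3 c2

/-- `C⁻_n(c1,c2,c3; M) = A⁻_{−n−c23−1}(c1,c2,c3; M)`. -/
def Cm (n c1 c2 c3 M : ℝ) : ℝ := Am (-n-c2-c3-1) c1 c2 c3 M

/-- `Σ⁻_n = A⁻_n + C⁻_n + (M+c12+1)(M+c123+1)`. -/
def Sm (n c1 c2 c3 M : ℝ) : ℝ :=
  Am n c1 c2 c3 M + Cm n c1 c2 c3 M + (M+c1+c2+1)*(M+c1+c2+c3+1)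

/-- `μ⁺_n(c123, c1; M) = (n+c123+M+2)(n−M−1−c1)`. -/
def muP (n c123 c1 M : ℝ) : ℝ := (n+c123+M+2)*(n-M-1-c1)

/-- `B⁺(x; c1,c2,c3; M)`. -/
def Bp (x c1 c2 c3 M : ℝ) : ℝ := -(x+c1+c2+c3+M+2)*(x+c1+c2+c3+M+3)*Ffun x c1 c2

/-- `D⁺(x; c1,c2,c3; M) = B⁺(−x−c12−1; c1,c2,c3; M)`. -/
def Dp (x c1 c2 c3 M : ℝ) : ℝ := Bp (-x-c1-c2-1) c1 c2 c3 M

/-- `S⁺ = B⁺ + D⁺ + (c23+M+2)(c123+M+2)`. -/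
def SpD (x c1 c2 c3 M : ℝ) : ℝ :=
  Bp x c1 c2 c3 M + Dp x c1 c2 c3 M + (c2+c3+M+2)*(c1+c2+c3+M+2)

/-- `μ⁻_n(c23; M) = (n−M)(n+c23+M+1)`. -/
def muM (n c23 M : ℝ) : ℝ := (n-M)*(n+c23+M+1)

/-- `B⁻(x; c1,c2; M)`. -/
def Bm (x c1 c2 M : ℝ) : ℝ := -(x-M)*(x-M+1)*Ffun x c1 c2

/-- `D⁻(x; c1,c2; M) = B⁻(−x−c12−1; c1,c2; M)`. -/
def Dm (x c1 c2 M : ℝ) : ℝ := Bm (-x-c1-c2-1) c1 c2 M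

/-- `S⁻ = B⁻ + D⁻ + M(c1+M)`. -/
def SmD (x c1 c2 M : ℝ) : ℝ := Bm x c1 c2 M + Dm x c1 c2 M + M*(c1+M)

/-- Nine-point recurrence coefficients `A^{e,e'}_{i,j}(c1,c2,c3,c4)` (with
`c0 = −2N−3−c1−c2−c3−c4`). -/
def nineA (e e' : ℤ) (i j : ℝ) (c1 c2 c3 c4 N : ℝ) : ℝ :=
  let c0 : ℝ := -2*N-3-c1-c2-c3-c4
  if e = 1 ∧ e' = 1 then -(Ffun (-j-c0-c4-1) c4 c0) * Cm i c1 c2 c3 (N-j+1)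
  else if e = 0 ∧ e' = 1 then (Ffun (-j-c0-c4-1) c4 c0) * Sm i c1 c2 c3 (N-j+1)
  else if e = -1 ∧ e' = 1 then -(Ffun (-j-c0-c4-1) c4 c0) * Am i c1 c2 c3 (N-j+1)
  else if e = 1 ∧ e' = -1 then -(Ffun j c4 c0) * Cp i c2 c3 (N-j-1)
  else if e = 0 ∧ e' = -1 then (Ffun j c4 c0) * Sp i c2 c3 (N-j-1)
  else if e = -1 ∧ e' = -1 then -(Ffun j c4 c0) * Ap i c2 c3 (N-j-1)
  else if e = 1 ∧ e' = 0 then (Ffun j c4 c0 + Ffun (-j-c0-c4-1) c4 c0) * coefC i c1 c2 c3 (N-j)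
  else if e = 0 ∧ e' = 0 then
    -(Ffun j c4 c0 + Ffun (-j-c0-c4-1) c4 c0) *
      (coefSig i c1 c2 c3 (N-j) + (N-j)^2 + (c1+c2+c3+2)*(N-j) + (1/2)*(c3+1)*(c1+c2+c3+1))
  else if e = -1 ∧ e' = 0 then (Ffun j c4 c0 + Ffun (-j-c0-c4-1) c4 c0) * coefA i c1 c2 c3 (N-j)
  else 0

/-- `Γ^{0,0}_{i,j}(c1,c2,c3,c4)`. -/
def gam00 (i j : ℝ) (c1 c2 c3 c4 N : ℝ) : ℝ :=
  let c0 : ℝ := -2*N-3-c1-c2-c3-c4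
  (-(coefSig i c1 c2 c3 (N-j)) + coefSig j c1 c0 c4 (N-i) - (1/4)*(c3^2-c4^2)
    + (i-N-(1/2)*(c4+1))*(i+(1/2)*(c2+c3-c0-c1))
    - (j-N-(1/2)*(c3+1))*(j+(1/2)*(c0+c4-c1-c2)))

/-- `Γ^{e,e'}_{i,j}` coefficients. -/
def gam (e e' : ℤ) (i j : ℝ) (c1 c2 c3 c4 N : ℝ) : ℝ :=
  let c0 : ℝ := -2*N-3-c1-c2-c3-c4
  if e = 0 ∧ e' = 1 then coefC j c1 c0 c4 (N-i)
  else if e = 0 ∧ e' = -1 then coefA j c1 c0 c4 (N-i)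
  else if e = 1 ∧ e' = 0 then coefC i c1 c2 c3 (N-j)
  else if e = -1 ∧ e' = 0 then coefA i c1 c2 c3 (N-j)
  else if e = 0 ∧ e' = 0 then gam00 i j c1 c2 c3 c4 N
  else 0

/-- Nine-point difference coefficients `D^{e,e'}(x,y; c1,c2,c3,c4)` (with
`c0 = −2N−3−c1−c2−c3−c4`). -/
def nineD (e e' : ℤ) (x y : ℝ) (c1 c2 c3 c4 N : ℝ) : ℝ :=
  let c0 : ℝ := -2*N-3-c1-c2-c3-c4
  if e = 1 ∧ e' = 1 then -(Ffun x c1 c2) * Bm y c3 c0 (N-x)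
  else if e = 1 ∧ e' = 0 then (Ffun x c1 c2) * SmD y c3 c0 (N-x)
  else if e = 1 ∧ e' = -1 then -(Ffun x c1 c2) * Dm y c3 c0 (N-x)
  else if e = -1 ∧ e' = 1 then -(Ffun (-x-c1-c2-1) c1 c2) * Bp y c3 c0 c4 (N-x)
  else if e = -1 ∧ e' = 0 then (Ffun (-x-c1-c2-1) c1 c2) * SpD y c3 c0 c4 (N-x)
  else if e = -1 ∧ e' = -1 then -(Ffun (-x-c1-c2-1) c1 c2) * Dp y c3 c0 c4 (N-x)
  else if e = 0 ∧ e' = 1 then (Ffun x c1 c2 + Ffun (-x-c1-c2-1) c1 c2) * coefB y c3 c0 c4 (N-x)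
  else if e = 0 ∧ e' = 0 then
    -(Ffun x c1 c2 + Ffun (-x-c1-c2-1) c1 c2) *
      (coefS y c3 c0 c4 (N-x) + (N-x)^2 + (c0+c3+c4+2)*(N-x) + (1/2)*(c3+1)*(c0+c3+c4+1))
  else if e = 0 ∧ e' = -1 then (Ffun x c1 c2 + Ffun (-x-c1-c2-1) c1 c2) * coefD y c3 c0 c4 (N-x)
  else 0

/-- `Ψ^{a,b}(x,y)` coefficients: the first superscript refers to the shift in `y`,
the second to the shift in `x` (with `c0 = −2N−3−c1−c2−c3−c4`). -/
def psi (a b : ℤ) (x y : ℝ) (c1 c2 c3 c4 N : ℝ) : ℝ :=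
  let c0 : ℝ := -2*N-3-c1-c2-c3-c4
  if a = 0 ∧ b = 1 then coefB x c4 c2 c1 (N-y)
  else if a = 0 ∧ b = -1 then coefD x c4 c2 c1 (N-y)
  else if a = 1 ∧ b = 0 then coefB y c3 c0 c1 (N-x)
  else if a = -1 ∧ b = 0 then coefD y c3 c0 c1 (N-x)
  else if a = 0 ∧ b = 0 then gam00 x y c1 c2 c4 c3 N
  else 0

/-- Tratnik polynomial of Racah type `T_{i,j}(x,y; c1,c2,c3,c4; N)`, set to `0` outside
the triangular domains. -/
def trat (c1 c2 c3 c4 : ℝ) (Nn : ℕ) (i j x y : ℤ) : ℝ :=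
  let c0 : ℝ := -2*(Nn:ℝ)-3-c1-c2-c3-c4
  if 0 ≤ i ∧ 0 ≤ j ∧ i + j ≤ (Nn:ℤ) ∧ 0 ≤ x ∧ 0 ≤ y ∧ x + y ≤ (Nn:ℤ) then
    racah i (x:ℝ) c1 c2 c3 ((Nn:ℤ)-j) * racah j (y:ℝ) c3 c0 c4 ((Nn:ℤ)-x)
  else 0

/-- Griffiths polynomial of Racah type `G_{i,j}(x,y; c1,c2,c3,c4; N)`, set to `0` outside
the triangular domains. -/
def grif (c1 c2 c3 c4 : ℝ) (Nn : ℕ) (i j x y : ℤ) : ℝ :=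
  let c0 : ℝ := -2*(Nn:ℝ)-3-c1-c2-c3-c4
  if 0 ≤ i ∧ 0 ≤ j ∧ i + j ≤ (Nn:ℤ) ∧ 0 ≤ x ∧ 0 ≤ y ∧ x + y ≤ (Nn:ℤ) then
    ∑ a ∈ Finset.range (((Nn:ℤ)-j).toNat + 1),
      (-1:ℝ)^a * racah i (a:ℝ) c1 c2 c3 ((Nn:ℤ)-j) * racah j (y:ℝ) c3 c0 c4 ((Nn:ℤ)-(a:ℤ)) *
        racah (a:ℤ) (x:ℝ) c4 c2 c1 ((Nn:ℤ)-y)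
  else 0

/-- Krawtchouk polynomial `K_n(x; p; M)`, set to `0` unless `0 ≤ n ≤ M`. -/
def kraw (n : ℤ) (x : ℝ) (p : ℝ) (M : ℤ) : ℝ :=
  if 0 ≤ n ∧ n ≤ M then
    (M.toNat.choose n.toNat : ℝ) * (p/(1-p))^n.toNat *
      ∑ k ∈ Finset.range (n.toNat + 1),
        poch (-(n:ℝ)) k * poch (-x) k / (poch (-(M:ℝ)) k * (Nat.factorial k : ℝ)) * (1/p)^k
  else 0

theorem Generic.add_intCast {r : ℝ} (h : Generic r) (m : ℤ) : Generic (r + m) := by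
  intro k hk
  exact h (k - m) (by push_cast; linarith)

theorem Generic.neg {r : ℝ} (h : Generic r) : Generic (-r) := by
  intro k hk
  exact h (-k) (by push_cast; linarith)

theorem Generic.ne_zero {r : ℝ} (h : Generic r) : r ≠ 0 := by
  simpa using h 0

theorem Generic.of_eq_add {r s : ℝ} (h : Generic r) (m : ℤ) (hs : s = r + m) : Generic s :=
  hs ▸ h.add_intCast m

theorem Generic.poch_ne_zero {r : ℝ} (h : Generic r) (k : ℕ) : poch r k ≠ 0 :=
  Finset.prod_ne_zero_iff.2 fun i _ => by simpa using (h.add_intCast i).ne_zero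

theorem poch_add (r : ℝ) (m n : ℕ) : poch r (m + n) = poch r m * poch (r + m) n := by
  simp only [poch, Finset.prod_range_add]
  congr 1
  exact Finset.prod_congr rfl fun i _ => by push_cast; ring

/-- Reflection of the Pochhammer symbol: `(r)_k = (-1)^k (1-r-k)_k`. -/
theorem poch_reflect {r s : ℝ} {k : ℕ} (h : r + s + k = 1) :
    poch r k = (-1) ^ k * poch s k := by
  unfold poch
  rw [← Finset.prod_range_reflect, ← Finset.card_range k, ← Finset.prod_const,
    Finset.card_range, ← Finset.prod_mul_distrib]
  refine Finset.prod_congr rfl fun i hi => ?_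
  have hi' : 1 + i ≤ k := by have := Finset.mem_range.1 hi; omega
  rw [Nat.sub_sub, Nat.cast_sub hi']
  push_cast
  linarith

theorem Lam_natCast (x M : ℕ) (c1 c2 : ℝ) :
    Lam x c1 c2 M = (-1) ^ x * (M.choose x : ℝ) * (2 * (x : ℝ) + c1 + c2 + 1) * poch (c2 + 1) x /
      (poch (c1 + 1) x * poch ((x : ℝ) + c1 + c2 + 1) (M + 1)) := by
  simp [Lam]

theorem Om_natCast (n k : ℕ) (c1 c2 c3 : ℝ) :
    Om n c1 c2 c3 (n + k : ℕ) =
      ((n + k).choose n : ℝ) * (2 * (n : ℝ) + c2 + c3 + 1) * poch (c2 + 1) n *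
        poch ((n : ℝ) + k + 2 + c1 + c2 + c3) n * poch (c1 + 1) k /
        (poch (c3 + 1) n * poch (c2 + c3 + (n : ℝ) + 1) (n + k + 1)) := by
  have h : (((n + k : ℕ) : ℤ) - n).toNat = k := by omega
  simp only [Om, h, Int.toNat_natCast, Int.cast_natCast]
  push_cast
  rfl

theorem Lam_ne_zero {c1 c2 : ℝ} (h1 : Generic c1) (h2 : Generic c2) (h12 : Generic (c1 + c2))
    {x M : ℕ} (hx : x ≤ M) : Lam x c1 c2 M ≠ 0 := by
  have e1 : (M.choose x : ℝ) ≠ 0 := by exact_mod_cast (Nat.choose_pos hx).ne'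
  have e2 := (h12.of_eq_add (s := 2 * (x : ℝ) + c1 + c2 + 1) (2 * x + 1)
    (by push_cast; ring)).ne_zero
  have e3 := (h2.of_eq_add (s := c2 + 1) 1 (by simp)).poch_ne_zero x
  have e4 := (h1.of_eq_add (s := c1 + 1) 1 (by simp)).poch_ne_zero x
  have e5 := (h12.of_eq_add (s := (x : ℝ) + c1 + c2 + 1) (x + 1)
    (by push_cast; ring)).poch_ne_zero (M + 1)
  rw [Lam_natCast]
  positivity

theorem Om_ne_zero {c1 c2 c3 : ℝ} (h1 : Generic c1) (h2 : Generic c2) (h3 : Generic c3)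
    (h23 : Generic (c2 + c3)) (h123 : Generic (c1 + c2 + c3)) (n k : ℕ) :
    Om n c1 c2 c3 (n + k : ℕ) ≠ 0 := by
  have e1 : ((n + k).choose n : ℝ) ≠ 0 := by
    exact_mod_cast (Nat.choose_pos (Nat.le_add_right n k)).ne'
  have e2 := (h23.of_eq_add (s := 2 * (n : ℝ) + c2 + c3 + 1) (2 * n + 1)
    (by push_cast; ring)).ne_zero
  have e3 := (h2.of_eq_add (s := c2 + 1) 1 (by simp)).poch_ne_zero n
  have e4 := (h123.of_eq_add (s := (n : ℝ) + k + 2 + c1 + c2 + c3) (n + k + 2)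
    (by push_cast; ring)).poch_ne_zero n
  have e5 := (h1.of_eq_add (s := c1 + 1) 1 (by simp)).poch_ne_zero k
  have e6 := (h3.of_eq_add (s := c3 + 1) 1 (by simp)).poch_ne_zero n
  have e7 := (h23.of_eq_add (s := c2 + c3 + (n : ℝ) + 1) (n + 1)
    (by push_cast; ring)).poch_ne_zero (n + k + 1)
  rw [Om_natCast]
  positivity

theorem choose_mul_choose_comm (a y k : ℕ) :
    (y + (a + k)).choose y * (a + k).choose a = (a + (y + k)).choose a * (y + k).choose y := by
  have h1 := Nat.add_choose_mul_factorial_mul_factorial y (a + k)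
  have h2 := Nat.add_choose_mul_factorial_mul_factorial a k
  have h3 := Nat.add_choose_mul_factorial_mul_factorial a (y + k)
  have h4 := Nat.add_choose_mul_factorial_mul_factorial y k
  have hpos : 0 < a.factorial * y.factorial * k.factorial := by positivity
  refine Nat.eq_of_mul_eq_mul_right hpos ?_
  rw [← h2] at h1
  rw [← h4] at h3
  rw [Nat.choose_symm_add (a := y), Nat.choose_symm_add (a := a) (b := k),
    Nat.choose_symm_add (a := a), Nat.choose_symm_add (a := y) (b := k)]
  rw [Nat.add_left_comm y a k] at h1 ⊢
  linarith

/-- Exchange relation between the weight `Λ` and the normalization `Ω`. -/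
theorem Lam_mul_Om_comm {c0 c1 c2 c3 c4 : ℝ} (a y k : ℕ)
    (hsum : c0 + c1 + c2 + c3 + c4 = -2 * ((y : ℝ) + a + k) - 3)
    (h1 : Generic c1) (h3 : Generic c3) (h12 : Generic (c1 + c2)) (h03 : Generic (c0 + c3)) :
    Lam y c3 c0 (y + (a + k) : ℕ) * Om a c4 c2 c1 (a + k : ℕ) =
      Lam a c1 c2 (a + (y + k) : ℕ) * Om y c4 c0 c3 (y + k : ℕ) := by
  have hchoose : (((y + (a + k)).choose y : ℕ) : ℝ) * ((a + k).choose a : ℕ) =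
      ((a + (y + k)).choose a : ℕ) * ((y + k).choose y : ℕ) := by
    exact_mod_cast choose_mul_choose_comm a y k
  have e1 := (h1.of_eq_add (s := c1 + 1) 1 (by simp)).poch_ne_zero a
  have e3 := (h3.of_eq_add (s := c3 + 1) 1 (by simp)).poch_ne_zero y
  have g12 : Generic ((a : ℝ) + c1 + c2 + 1) := h12.of_eq_add (a + 1) (by push_cast; ring)
  have g03 : Generic ((y : ℝ) + c3 + c0 + 1) := h03.of_eq_add (y + 1) (by push_cast; ring)
  have s1 := poch_add ((a : ℝ) + c1 + c2 + 1) (a + k + 1) y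
  have s2 := poch_add ((y : ℝ) + c3 + c0 + 1) (y + k + 1) a
  have r1 : poch ((y : ℝ) + k + 2 + c4 + c0 + c3) y =
      (-1) ^ y * poch ((a : ℝ) + c1 + c2 + 1 + (a + k + 1 : ℕ)) y :=
    poch_reflect (by push_cast; linarith)
  have r2 : poch ((a : ℝ) + k + 2 + c4 + c2 + c1) a =
      (-1) ^ a * poch ((y : ℝ) + c3 + c0 + 1 + (y + k + 1 : ℕ)) a :=
    poch_reflect (by push_cast; linarith)
  have n1 := g12.poch_ne_zero (a + k + 1 + y)
  have n2 := g03.poch_ne_zero (y + k + 1 + a)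
  rw [s1, mul_ne_zero_iff] at n1
  rw [s2, mul_ne_zero_iff] at n2
  obtain ⟨n1, n1'⟩ := n1
  obtain ⟨n2, n2'⟩ := n2
  rw [Lam_natCast, Lam_natCast, Om_natCast, Om_natCast,
    show y + (a + k) + 1 = y + k + 1 + a by omega,
    show a + (y + k) + 1 = a + k + 1 + y by omega, s1, s2, r1, r2,
    show c2 + c1 + (a : ℝ) + 1 = (a : ℝ) + c1 + c2 + 1 by ring,
    show c0 + c3 + (y : ℝ) + 1 = (y : ℝ) + c3 + c0 + 1 by ring]
  generalize poch ((a : ℝ) + c1 + c2 + 1 + (a + k + 1 : ℕ)) y = P at *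
  generalize poch ((y : ℝ) + c3 + c0 + 1 + (y + k + 1 : ℕ)) a = Q at *
  generalize poch ((a : ℝ) + c1 + c2 + 1) (a + k + 1) = R at *
  generalize poch ((y : ℝ) + c3 + c0 + 1) (y + k + 1) = S at *
  rw [div_mul_div_comm, div_mul_div_comm, div_eq_div_iff (by positivity) (by positivity)]
  linear_combination ((-1) ^ y * (-1) ^ a * (2 * (y : ℝ) + c3 + c0 + 1) *
    (2 * (a : ℝ) + c1 + c2 + 1) * poch (c0 + 1) y * poch (c2 + 1) a * poch (c4 + 1) k *
    poch (c1 + 1) a * poch (c3 + 1) y * P * Q * R * S) * hchoose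

/-- ratio identity between the weights `Λ` and the normalizations `Ω`
used for the Griffiths polynomials. -/
theorem lam_om_ratio_griffiths
    (Nn : ℕ) (c0 c1 c2 c3 c4 : ℝ)
    (hsum : c0+c1+c2+c3+c4 = -2*(Nn:ℝ)-3)
    (hgen : Generic4 c1 c2 c3 c4)
    (a j y : ℤ) (ha : 0 ≤ a) (hj : 0 ≤ j) (hy : 0 ≤ y)
    (haj : a + j ≤ (Nn:ℤ)) (hay : a + y ≤ (Nn:ℤ)) :
    Lam y c3 c0 (Nn:ℤ) / Lam j c4 c0 (Nn:ℤ) =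
      (Om y c4 c0 c3 ((Nn:ℤ)-a) * Om a c3 c2 c1 ((Nn:ℤ)-j)) /
        (Om j c3 c0 c4 ((Nn:ℤ)-a) * Om a c4 c2 c1 ((Nn:ℤ)-y)) := by
  obtain ⟨h1, h2, h3, h4, h12, -, -, -, -, -, h123, h124, -, -, -⟩ := hgen
  have h03 : Generic (c0 + c3) := h124.neg.of_eq_add (-2 * Nn - 3) (by push_cast; linarith)
  have h04 : Generic (c0 + c4) := h123.neg.of_eq_add (-2 * Nn - 3) (by push_cast; linarith)
  have h321 : Generic (c3 + c2 + c1) := h123.of_eq_add 0 (by push_cast; ring)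
  have h421 : Generic (c4 + c2 + c1) := h124.of_eq_add 0 (by push_cast; ring)
  have h21 : Generic (c2 + c1) := h12.of_eq_add 0 (by push_cast; ring)
  lift a to ℕ using ha
  lift j to ℕ using hj
  lift y to ℕ using hy
  obtain ⟨k, hk⟩ := Nat.exists_eq_add_of_le (show a + y ≤ Nn by omega)
  obtain ⟨l, hl⟩ := Nat.exists_eq_add_of_le (show a + j ≤ Nn by omega)
  have key_y := Lam_mul_Om_comm (c0 := c0) (c4 := c4) a y k
    (by rw [hsum, hk]; push_cast; ring) h1 h3 h12 h03
  have key_j := Lam_mul_Om_comm (c0 := c0) (c4 := c3) a j l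
    (by rw [add_right_comm _ c4 c3, hsum, hl]; push_cast; ring) h1 h4 h12 h04
  have hL := Lam_ne_zero h1 h2 h12 (show a ≤ Nn by omega)
  have hOy := Om_ne_zero h4 h2 h1 h21 h421 a k
  have hOj := Om_ne_zero h3 h2 h1 h21 h321 a l
  rw [show y + (a + k) = Nn by omega, show a + (y + k) = Nn by omega] at key_y
  rw [show j + (a + l) = Nn by omega, show a + (j + l) = Nn by omega] at key_j
  rw [show (Nn : ℤ) - y = (a + k : ℕ) by omega, show (Nn : ℤ) - j = (a + l : ℕ) by omega]
  rw [show ((y + k : ℕ) : ℤ) = Nn - a by omega] at key_y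
  rw [show ((j + l : ℕ) : ℤ) = Nn - a by omega] at key_j
  rw [eq_div_of_mul_eq hOy key_y, eq_div_of_mul_eq hOj key_j, div_div_div_eq]
  rw [show ∀ u v w x z : ℝ, u * v * w / (x * (u * z)) = u * (v * w) / (u * (z * x)) by
    intros; ring_nf]
  exact mul_div_mul_left _ _ hL
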